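/- arXiv:2206.02883 — 4 statements merged into one kernel-verified Lean document; each statement's English description precedes it below -/
import Mathlib

section
/- Let p, c, c_lc, g_s, g_ns be real numbers with 0 < p ≤ 1, c > 0, and c_lc ≥ 0. If p·(c_lc + c + g_ns) + (1 − p)·(c + g_s) ≤ c + g_s, then p·(c_lc + c + g_ns) + (1 − p)·(c + g_s) > g_ns. -/
theorem stmt_5 (p c c_lc g_s g_ns : ℝ) (hp0 : 0 < p) (hp1 : p ≤ 1)
    (hc : 0 < c) (hlc : 0 ≤ c_lc)
    (h : p * (c_lc + c + g_ns) + (1 - p) * (c + g_s) ≤ c + g_s) :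
    p * (c_lc + c + g_ns) + (1 - p) * (c + g_s) > g_ns := by
  have hle : c_lc + c + g_ns ≤ c + g_s :=
    le_of_mul_le_mul_left (by linarith) hp0
  have hmix := mul_le_mul_of_nonneg_left hle (sub_nonneg.mpr hp1)
  linarith
end

section
/- Let α > 0, ℓ > 0, c > 0, c_lc ≥ 0, c_flc ≥ 0 be real numbers with c/ℓ ≥ α·c_flc, and set p = 1 − exp(−αℓ). For any real numbers g_s, g_ns, if p·(c_lc + c + g_ns) + (1 − p)·(c + g_s) ≤ c_lc + c + (1 − p)·c_flc + g_ns, then p·(c_lc + c + g_ns) + (1 − p)·(c + g_s) > g_s. -/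
theorem stmt_7 (α ℓ c c_lc c_flc : ℝ) (hα : 0 < α) (hℓ : 0 < ℓ) (hc : 0 < c)
    (hlc : 0 ≤ c_lc) (hflc : 0 ≤ c_flc) (hcond : c / ℓ ≥ α * c_flc)
    (g_s g_ns : ℝ) :
    let p := 1 - Real.exp (-α * ℓ)
    p * (c_lc + c + g_ns) + (1 - p) * (c + g_s) ≤
        c_lc + c + (1 - p) * c_flc + g_ns →
      p * (c_lc + c + g_ns) + (1 - p) * (c + g_s) > g_s := by
  intro p h
  have hexp : 0 < 1 - p := by simp [p, Real.exp_pos]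
  have hp : 0 < p := by
    have : Real.exp (-α * ℓ) < 1 := Real.exp_lt_one_iff.2 (by nlinarith [mul_pos hα hℓ])
    simp only [p]
    linarith
  have hp_lt : p < α * ℓ := by
    have := Real.add_one_lt_exp (x := -α * ℓ) (by nlinarith [mul_pos hα hℓ])
    simp only [p]
    linarith
  have hcℓ : α * c_flc * ℓ ≤ c := (le_div_iff₀ hℓ).1 hcond
  have hpc : p * c_flc < c := by
    rcases hflc.eq_or_lt with h0 | hpos
    · simpa [← h0] using hc
    · nlinarith [mul_lt_mul_of_pos_right hp_lt hpos]
  have hgs : g_s ≤ c_lc + g_ns + c_flc :=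
    le_of_mul_le_mul_left (by linarith) hexp
  nlinarith [mul_le_mul_of_nonneg_left hgs hp.le]
end

section
/- Let α > 0, ℓ > 0, c > 0, c_lc ≥ 0, c_flc ≥ 0 be real numbers with c/ℓ ≥ α·c_flc, and set p = 1 − exp(−αℓ). For any real numbers g_s, g_ns, if q_lc := p·(c_lc + c + g_ns) + (1 − p)·(c + g_s) satisfies both q_lc ≤ c + g_s and q_lc ≤ c_lc + c + (1 − p)·c_flc + g_ns, then q_lc > g_ns and q_lc > g_s. -/
theorem stmt_8 (α ℓ c c_lc c_flc : ℝ) (hα : 0 < α) (hℓ : 0 < ℓ) (hc : 0 < c)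
    (hlc : 0 ≤ c_lc) (hflc : 0 ≤ c_flc) (hcond : c / ℓ ≥ α * c_flc)
    (g_s g_ns : ℝ) :
    let p := 1 - Real.exp (-α * ℓ)
    let q_lc := p * (c_lc + c + g_ns) + (1 - p) * (c + g_s)
    q_lc ≤ c + g_s →
      q_lc ≤ c_lc + c + (1 - p) * c_flc + g_ns →
        q_lc > g_ns ∧ q_lc > g_s := by
  intro p q_lc h_stay h_forced
  have hαℓ : 0 < α * ℓ := mul_pos hα hℓ
  have hp_pos : 0 < p := by
    have : Real.exp (-α * ℓ) < 1 := Real.exp_lt_one_iff.mpr (by linarith)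
    simp only [p]
    linarith
  have hp_lt_one : 0 < 1 - p := by
    simp only [p, sub_sub_cancel]
    exact Real.exp_pos _
  have hp_lt : p < α * ℓ := by
    have := Real.add_one_lt_exp (x := -α * ℓ) (by linarith)
    simp only [p]
    linarith
  have hc_ge : α * c_flc * ℓ ≤ c := (le_div_iff₀ hℓ).mp hcond
  have hc_gt : p * c_flc < c := by
    rcases hflc.eq_or_lt with h | h
    · simpa [← h] using hc
    · linarith [mul_lt_mul_of_pos_right hp_lt h]
  have hq : q_lc = c + g_s + p * (c_lc + g_ns - g_s) := by
    simp only [q_lc]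
    ring
  clear_value q_lc p
  subst hq
  have h_ns : c_lc + g_ns ≤ g_s := by
    by_contra! h
    linarith [mul_pos hp_pos (sub_pos.mpr h)]
  have h_s : g_s ≤ c_lc + g_ns + c_flc := by
    by_contra! h
    linarith [mul_pos hp_lt_one (sub_pos.mpr h)]
  constructor
  · linarith [mul_nonneg hp_lt_one.le (sub_nonneg.mpr h_ns)]
  · linarith [mul_nonneg hp_pos.le (sub_nonneg.mpr h_s)]
end

section
/- Let α > 0 and c_lc be real, and let g(x) = x + c_lc + exp(−αx)/α. Then for every Δx > 0, g(Δx) − g(0) < Δx; equivalently, with ℓ ∈ ℝ and the heuristic h(x) = ℓ − x, the consistency condition h(0) ≤ h(Δx) + (g(Δx) − g(0)) fails for every Δx > 0. -/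
theorem stmt_10 (α c_lc ℓ : ℝ) (hα : 0 < α) :
    ∀ Δx : ℝ, 0 < Δx →
      (let g : ℝ → ℝ := fun x => x + c_lc + Real.exp (-α * x) / α
       let h : ℝ → ℝ := fun x => ℓ - x
       g Δx - g 0 < Δx ∧ ¬ (h 0 ≤ h Δx + (g Δx - g 0))) := by
  intro Δx hx g h
  have hexp : Real.exp (-α * Δx) / α < 1 / α :=
    div_lt_div_of_pos_right (Real.exp_lt_one_iff.mpr (by nlinarith)) hα
  have hg : g Δx - g 0 < Δx := by
    simp only [g, mul_zero, Real.exp_zero]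
    linarith
  refine ⟨hg, not_le.mpr ?_⟩
  simp only [h]
  linarith
end
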